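/- arXiv:1209.2966 — 3 statements merged into one kernel-verified Lean document; each statement's English description precedes it below -/
import Mathlib

section
/- Let A be a commutative unital ℝ-algebra, d ≥ 1, and S ⊆ A an archimedean Σ A^{2d}-module (1 ∈ S, S+S ⊆ S, a^{2d}·S ⊆ S for all a, and for each a ∈ A there is n ∈ ℕ with n + a ∈ S). If a ∈ A satisfies α(a) > 0 for every unital ℝ-algebra homomorphism α : A → ℝ that is nonnegative on S, then a ∈ S. -/
open Filter Topology

/-- The generalized binomial coefficients of an exponent in `[0, 1]` are bounded by one. -/
theorem Ring.abs_choose_le_one {x : ℝ} (hx0 : 0 ≤ x) (hx1 : x ≤ 1) (n : ℕ) :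
    |Ring.choose x n| ≤ 1 := by
  have bound : ∀ n : ℕ, |(descPochhammer ℤ n).smeval x| ≤ (n.factorial : ℝ) := by
    intro n
    induction n with
    | zero => simp
    | succ n ih =>
      rw [descPochhammer_succ_right, Polynomial.smeval_mul, abs_mul, Nat.factorial_succ,
        Nat.cast_mul, mul_comm]
      refine mul_le_mul ?_ ih (abs_nonneg _) (by positivity)
      simp only [Polynomial.smeval_sub, Polynomial.smeval_X, Polynomial.smeval_natCast, npow_one,
        npow_zero, nsmul_one, Nat.cast_add, Nat.cast_one]
      have : (0 : ℝ) ≤ n := n.cast_nonneg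
      rw [abs_le]
      constructor <;> linarith
  have h := bound n
  rw [Ring.descPochhammer_eq_factorial_smul_choose, nsmul_eq_mul, abs_mul, Nat.abs_cast] at h
  have hpos : (0 : ℝ) < n.factorial := by exact_mod_cast n.factorial_pos
  exact le_of_mul_le_mul_left (by simpa using h) hpos

namespace PowerSeries

theorem binomialSeries_inv_natCast_pow {m : ℕ} (hm : m ≠ 0) :
    binomialSeries ℝ ((m : ℝ)⁻¹) ^ m = 1 + X := by
  have h : ∀ (r : ℝ) (k : ℕ), binomialSeries ℝ r ^ k = binomialSeries ℝ (k * r) := by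
    intro r k
    induction k with
    | zero => simp
    | succ k ih => rw [pow_succ, ih, ← binomialSeries_add]; push_cast; ring_nf
  rw [h, mul_inv_cancel₀ (by exact_mod_cast hm)]
  simpa using binomialSeries_nat (R := ℝ) (A := ℝ) 1

/-- The coefficients of powers of a series with coefficients in `[-1, 1]` are bounded by those of
the powers of the geometric series. -/
theorem abs_coeff_pow_succ_le {f : PowerSeries ℝ} (hf : ∀ n, |coeff n f| ≤ 1) (m n : ℕ) :
    |coeff n (f ^ (m + 1))| ≤ ((n + m).choose m : ℝ) := by
  have h : ∀ m n, |coeff n (f ^ m)| ≤ coeff n ((mk 1 : PowerSeries ℝ) ^ m) := by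
    intro m
    induction m with
    | zero => intro n; simp only [pow_zero, coeff_one]; split_ifs <;> simp
    | succ m ih =>
      intro n
      rw [pow_succ, pow_succ, coeff_mul, coeff_mul]
      refine (Finset.abs_sum_le_sum_abs _ _).trans (Finset.sum_le_sum fun p _ ↦ ?_)
      rw [abs_mul]
      exact mul_le_mul (ih _) (by simpa using hf _) (abs_nonneg _) ((abs_nonneg _).trans (ih _))
  have hn := h (m + 1) n
  rwa [mk_one_pow_eq_mk_choose_add, coeff_mk, add_comm m n] at hn

/-- A functional on polynomials with geometrically decaying values on monomials is continuous
along the truncations of a series with bounded coefficients. -/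
theorem tendsto_trunc_pow {f : PowerSeries ℝ} (hf : ∀ n, |coeff n f| ≤ 1) {m : ℕ} (hm : m ≠ 0)
    {q : Polynomial ℝ} (hq : f ^ m = q) (L : Polynomial ℝ →ₗ[ℝ] ℝ) {M r : ℝ} (hr0 : 0 ≤ r)
    (hr1 : r < 1) (hL : ∀ n, |L (Polynomial.X ^ n)| ≤ M * r ^ n) :
    Tendsto (fun N ↦ L (trunc N f ^ m)) atTop (𝓝 (L q)) := by
  have hsum : ∀ p : Polynomial ℝ, L p = ∑' n, p.coeff n * L (Polynomial.X ^ n) := by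
    intro p
    rw [tsum_eq_sum (s := p.support) fun n hn ↦ by simp [Polynomial.notMem_support_iff.1 hn]]
    conv_lhs => rw [p.as_sum_support, map_sum]
    refine Finset.sum_congr rfl fun n _ ↦ ?_
    rw [← Polynomial.smul_X_eq_monomial, map_smul, smul_eq_mul]
  obtain ⟨k, rfl⟩ := Nat.exists_eq_succ_of_ne_zero hm
  rw [hsum q]
  refine Tendsto.congr (fun N ↦ (hsum _).symm) ?_
  refine tendsto_tsum_of_dominated_convergence
    (bound := fun n ↦ M * (((n + k).choose k : ℝ) * r ^ n)) ?_ ?_ ?_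
  · exact (summable_choose_mul_geometric_of_norm_lt_one k
      (by rwa [Real.norm_of_nonneg hr0])).mul_left M
  · intro n
    refine tendsto_const_nhds.congr' ?_
    filter_upwards [eventually_gt_atTop n] with N hN
    congr 1
    have h := congrArg (fun p ↦ Polynomial.coeff p n) (trunc_trunc_pow f N (k + 1))
    simp only [coeff_trunc, hN, if_true] at h
    rw [hq, ← Polynomial.coe_pow, Polynomial.coeff_coe, Polynomial.coeff_coe] at h
    exact h.symm
  · refine Eventually.of_forall fun N n ↦ ?_
    rw [norm_mul, Real.norm_eq_abs, Real.norm_eq_abs, ← Polynomial.coeff_coe, Polynomial.coe_pow]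
    have htr : ∀ n, |coeff n (trunc N f : PowerSeries ℝ)| ≤ 1 := by
      intro n
      rw [Polynomial.coeff_coe, coeff_trunc]
      split_ifs
      · exact hf n
      · simp
    calc _ ≤ ((n + k).choose k : ℝ) * (M * r ^ n) :=
          mul_le_mul (abs_coeff_pow_succ_le htr k n) (hL n) (abs_nonneg _) (by positivity)
      _ = _ := by ring

end PowerSeries

/-- A functional on polynomials that is nonnegative on `m`-th powers and decays geometrically on
monomials is nonnegative at `1 + X`. -/
theorem Polynomial.map_one_add_X_nonneg {m : ℕ} (hm : m ≠ 0) (L : Polynomial ℝ →ₗ[ℝ] ℝ) {M r : ℝ}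
    (hr0 : 0 ≤ r) (hr1 : r < 1) (hL : ∀ n, |L (X ^ n)| ≤ M * r ^ n)
    (hpow : ∀ p : Polynomial ℝ, 0 ≤ L (p ^ m)) : 0 ≤ L (1 + X) := by
  refine ge_of_tendsto' (PowerSeries.tendsto_trunc_pow
    (f := PowerSeries.binomialSeries ℝ ((m : ℝ)⁻¹)) (fun n ↦ ?_) hm ?_ L hr0 hr1 hL)
    fun N ↦ hpow _
  · simpa using Ring.abs_choose_le_one (by positivity) (Nat.cast_inv_le_one m) n
  · simpa using PowerSeries.binomialSeries_inv_natCast_pow hm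

/-- `S` is an archimedean module over the sums of `2d`-th powers of `A`. -/
structure IsArchimedeanPowerModule {A : Type*} [CommRing A] [Algebra ℝ A] (d : ℕ)
    (S : Set A) : Prop where
  one_mem : 1 ∈ S
  add_mem : ∀ s ∈ S, ∀ t ∈ S, s + t ∈ S
  pow_mul_mem : ∀ a : A, ∀ s ∈ S, a ^ (2 * d) * s ∈ S
  exists_natCast_add_mem : ∀ a : A, ∃ n : ℕ, (n : A) + a ∈ S

/-- The normalized linear functionals on `A` that are nonnegative on `S`. -/
def stateSet {A : Type*} [CommRing A] [Algebra ℝ A] (S : Set A) : Set (A → ℝ) :=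
  {f | IsLinearMap ℝ f ∧ (∀ s ∈ S, 0 ≤ f s) ∧ f 1 = 1}

namespace IsArchimedeanPowerModule

variable {A : Type*} [CommRing A] [Algebra ℝ A] {d : ℕ} {S : Set A}

theorem smul_mem (hS : IsArchimedeanPowerModule d S) (hd : 1 ≤ d) {r : ℝ} (hr : 0 ≤ r) {s : A}
    (hs : s ∈ S) : r • s ∈ S := by
  have h := hS.pow_mul_mem (algebraMap ℝ A (r ^ ((2 * d : ℕ) : ℝ)⁻¹)) s hs
  rwa [← map_pow, Real.rpow_inv_natCast_pow hr (by omega), ← Algebra.smul_def] at h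

theorem zero_mem (hS : IsArchimedeanPowerModule d S) (hd : 1 ≤ d) : 0 ∈ S := by
  simpa using hS.smul_mem hd le_rfl hS.one_mem

theorem natCast_mem (hS : IsArchimedeanPowerModule d S) (hd : 1 ≤ d) (n : ℕ) : (n : A) ∈ S := by
  have h := hS.smul_mem hd (Nat.cast_nonneg n) hS.one_mem
  rwa [Nat.cast_smul_eq_nsmul, nsmul_one] at h

theorem exists_natCast_add_sub_mem (hS : IsArchimedeanPowerModule d S) (hd : 1 ≤ d) (a : A) :
    ∃ n : ℕ, (n : A) + a ∈ S ∧ (n : A) - a ∈ S := by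
  obtain ⟨n, hn⟩ := hS.exists_natCast_add_mem a
  obtain ⟨m, hm⟩ := hS.exists_natCast_add_mem (-a)
  refine ⟨n + m, ?_, ?_⟩
  · convert hS.add_mem _ hn _ (hS.natCast_mem hd m) using 1; push_cast; ring
  · convert hS.add_mem _ hm _ (hS.natCast_mem hd n) using 1; push_cast; ring

/-- An element outside of `S` is nonpositive at some state. -/
theorem exists_mem_stateSet_nonpos (hS : IsArchimedeanPowerModule d S) (hd : 1 ≤ d) {a : A}
    (ha : a ∉ S) : ∃ f ∈ stateSet S, f a ≤ 0 := by
  have hone : (1 : A) ≠ 0 := fun h ↦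
    ha (by rw [← mul_one a, h, mul_zero]; exact hS.zero_mem hd)
  let C : PointedCone ℝ A :=
    { carrier := {x | ∃ s ∈ S, ∃ t : ℝ, 0 ≤ t ∧ x = s - t • a}
      add_mem' := by
        rintro _ _ ⟨s, hs, t, ht, rfl⟩ ⟨s', hs', t', ht', rfl⟩
        exact ⟨s + s', hS.add_mem _ hs _ hs', t + t', by positivity, by rw [add_smul]; abel⟩
      zero_mem' := ⟨0, hS.zero_mem hd, 0, le_rfl, by simp⟩
      smul_mem' := by
        rintro ⟨c, hc⟩ _ ⟨s, hs, t, ht, rfl⟩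
        refine ⟨c • s, hS.smul_mem hd hc hs, c * t, by positivity, ?_⟩
        rw [Nonneg.mk_smul, smul_sub, mul_smul] }
  obtain ⟨g, hg, hgC⟩ := riesz_extension C 
    (LinearPMap.mkSpanSingleton (σ := RingHom.id ℝ) (1 : A) (1 : ℝ) hone) (by
      rintro ⟨x, hx⟩ hxC
      obtain ⟨r, rfl⟩ := Submodule.mem_span_singleton.1 hx
      obtain ⟨s, hs, t, ht, hst : r • (1 : A) = s - t • a⟩ := hxC
      rw [LinearPMap.mkSpanSingleton'_apply, smul_eq_mul, mul_one, RingHom.id_apply]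
      by_contra! hr
      rcases ht.eq_or_lt with rfl | ht
      · obtain ⟨n, hn⟩ := hS.exists_natCast_add_mem a
        have hneg : -(1 : A) ∈ S := by
          have h := hS.smul_mem hd (inv_nonneg.2 (neg_nonneg.2 hr.le)) hs
          rw [zero_smul, sub_zero] at hst
          rwa [← hst, smul_smul, inv_neg, neg_mul, inv_mul_cancel₀ hr.ne, neg_one_smul] at h
        have h := hS.smul_mem hd n.cast_nonneg hneg
        rw [Nat.cast_smul_eq_nsmul, nsmul_eq_mul] at h
        exact ha (by convert hS.add_mem _ hn _ h using 1; ring)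
      · refine ha ?_
        have h := hS.add_mem _ hs _ (hS.smul_mem hd (neg_nonneg.2 hr.le) hS.one_mem)
        rw [neg_smul, hst, neg_sub, add_sub_cancel] at h
        simpa [smul_smul, ht.ne'] using hS.smul_mem hd (inv_nonneg.2 ht.le) h) (by
      intro y
      obtain ⟨n, hn⟩ := hS.exists_natCast_add_mem y
      refine ⟨⟨(n : A), Submodule.mem_span_singleton.2 ⟨n, ?_⟩⟩, n + y, hn, 0, le_rfl, by simp⟩
      rw [Nat.cast_smul_eq_nsmul, nsmul_one])
  refine ⟨g, ⟨g.isLinear, fun s hs ↦ hgC s ⟨s, hs, 0, le_rfl, by simp⟩, ?_⟩, ?_⟩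
  · exact (hg ⟨1, Submodule.mem_span_singleton_self _⟩).trans
      (LinearPMap.mkSpanSingleton_apply ℝ ℝ hone 1)
  · have := hgC (-a) ⟨0, hS.zero_mem hd, 1, zero_le_one, by simp⟩
    rw [map_neg] at this
    linarith

theorem isCompact_stateSet (hS : IsArchimedeanPowerModule d S) (hd : 1 ≤ d) :
    IsCompact (stateSet S) := by
  choose n hn hn' using hS.exists_natCast_add_sub_mem hd
  have hbox := isCompact_univ_pi fun a : A ↦ isCompact_Icc (a := -(n a : ℝ)) (b := n a)
  refine hbox.of_isClosed_subset ?_ ?_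
  · have h : stateSet S = (⋂ x, ⋂ y, {f : A → ℝ | f (x + y) = f x + f y}) ∩
        (⋂ r : ℝ, ⋂ x, {f : A → ℝ | f (r • x) = r • f x}) ∩
        ((⋂ s ∈ S, {f : A → ℝ | 0 ≤ f s}) ∩ {f | f 1 = 1}) := by
      ext f
      simp only [Set.mem_inter_iff, Set.mem_iInter]
      exact ⟨fun h ↦ ⟨⟨h.1.map_add, h.1.map_smul⟩, h.2⟩, fun h ↦ ⟨⟨h.1.1, h.1.2⟩, h.2⟩⟩
    rw [h]
    refine ((isClosed_iInter fun x ↦ isClosed_iInter fun y ↦ ?_).inter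
      (isClosed_iInter fun r ↦ isClosed_iInter fun x ↦ ?_)).inter
      ((isClosed_biInter fun s _ ↦ ?_).inter ?_)
    · exact isClosed_eq (by fun_prop) (by fun_prop)
    · exact isClosed_eq (by fun_prop) (by fun_prop)
    · exact isClosed_le (by fun_prop) (by fun_prop)
    · exact isClosed_eq (by fun_prop) (by fun_prop)
  · rintro f ⟨hf, hfS, hf1⟩ a -
    have hnat : f (n a) = n a := by
      rw [← nsmul_one, ← Nat.cast_smul_eq_nsmul ℝ, hf.map_smul, hf1, smul_eq_mul, mul_one]
    have h1 := hfS _ (hn a)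
    have h2 := hfS _ (hn' a)
    rw [hf.map_add, hnat] at h1
    rw [hf.map_sub, hnat] at h2
    constructor <;> linarith

/-- If `n - b ^ (2 * d) ∈ S`, a functional nonnegative on `S` is nonnegative on
`(n + 1 - b ^ (2 * d)) * S`. -/
theorem map_sub_pow_mul_nonneg (hS : IsArchimedeanPowerModule d S) (hd : 1 ≤ d) (φ : A →ₗ[ℝ] ℝ)
    (hφ : ∀ s ∈ S, 0 ≤ φ s) {b : A} {n : ℕ} (hn : (n : A) - b ^ (2 * d) ∈ S) {s : A}
    (hs : s ∈ S) : 0 ≤ φ (((n + 1 : ℕ) - b ^ (2 * d)) * s) := by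
  set c := b ^ (2 * d) with hc
  have hcS : ∀ k, ∀ s ∈ S, c ^ k * s ∈ S := fun k s hs ↦ by
    rw [hc, pow_right_comm]; exact hS.pow_mul_mem _ s hs
  have hφ1 : ∀ k, φ (c ^ k) ≤ (n : ℝ) ^ k * φ 1 := by
    intro k
    induction k with
    | zero => simp
    | succ k ih =>
      have h := hφ _ (hcS k _ hn)
      rw [mul_sub, ← pow_succ, map_sub, mul_comm, ← nsmul_eq_mul, map_nsmul, nsmul_eq_mul] at h
      calc φ (c ^ (k + 1)) ≤ n * φ (c ^ k) := by linarith
        _ ≤ n * ((n : ℝ) ^ k * φ 1) := by gcongr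
        _ = _ := by ring
  obtain ⟨M, -, hM⟩ := hS.exists_natCast_add_sub_mem hd s
  have hbound : ∀ k, φ (c ^ k * s) ≤ M * φ 1 * (n : ℝ) ^ k := by
    intro k
    have h := hφ _ (hcS k _ hM)
    rw [mul_sub, map_sub, mul_comm, ← nsmul_eq_mul, map_nsmul, nsmul_eq_mul] at h
    calc φ (c ^ k * s) ≤ M * φ (c ^ k) := by linarith
      _ ≤ M * ((n : ℝ) ^ k * φ 1) := by gcongr; exact hφ1 k
      _ = _ := by ring
  have hn0 : (0 : ℝ) < n + 1 := by positivity
  let L : Polynomial ℝ →ₗ[ℝ] ℝ := φ ∘ₗ LinearMap.mulRight ℝ s ∘ₗ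
    (Polynomial.aeval (-(n + 1 : ℝ)⁻¹ • c)).toLinearMap
  have hL : ∀ p, L p = φ (Polynomial.aeval (-(n + 1 : ℝ)⁻¹ • c) p * s) := fun _ ↦ rfl
  have key := Polynomial.map_one_add_X_nonneg (m := 2 * d) (by omega) L (M := M * φ 1)
    (r := n / (n + 1)) (by positivity) (by rw [div_lt_one hn0]; linarith) (fun k ↦ ?_) (fun p ↦ ?_)
  · rw [hL, map_add, map_one, Polynomial.aeval_X] at key
    have h : (((n + 1 : ℕ) : A) - c) * s = (n + 1 : ℝ) • ((1 + -(n + 1 : ℝ)⁻¹ • c) * s) := by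
      rw [← smul_mul_assoc, smul_add, smul_smul, mul_neg, mul_inv_cancel₀ hn0.ne', neg_one_smul,
        ← sub_eq_add_neg, add_smul, one_smul, Nat.cast_smul_eq_nsmul, nsmul_one, Nat.cast_succ]
    rw [h, map_smul, smul_eq_mul]
    exact mul_nonneg hn0.le key
  · rw [hL, map_pow, Polynomial.aeval_X, smul_pow, smul_mul_assoc, map_smul, smul_eq_mul, abs_mul,
      abs_of_nonneg (hφ _ (hcS k s hs)), abs_pow, abs_neg, abs_of_pos (inv_pos.2 hn0)]
    calc _ ≤ ((n + 1 : ℝ)⁻¹) ^ k * (M * φ 1 * (n : ℝ) ^ k) := by gcongr; exact hbound k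
      _ = _ := by rw [div_pow, inv_pow]; ring
  · rw [hL, map_pow]
    exact hφ _ (hS.pow_mul_mem _ s hs)

/-- An extreme state is multiplicative with respect to `2d`-th powers. -/
theorem map_pow_mul_of_mem_extremePoints (hS : IsArchimedeanPowerModule d S) (hd : 1 ≤ d)
    (φ : A →ₗ[ℝ] ℝ) (hφ : ⇑φ ∈ (stateSet S).extremePoints ℝ) (b x : A) :
    φ (b ^ (2 * d) * x) = φ (b ^ (2 * d)) * φ x := by
  obtain ⟨⟨-, hφS, hφ1⟩, hext⟩ := hφ
  obtain ⟨n, -, hn⟩ := hS.exists_natCast_add_sub_mem hd (b ^ (2 * d))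
  have hnonneg := fun s hs ↦ hS.map_sub_pow_mul_nonneg hd φ hφS hn (s := s) hs
  set c := b ^ (2 * d) with hc
  have hcS : ∀ s ∈ S, 0 ≤ φ (c * s) := fun s hs ↦ hφS _ (hS.pow_mul_mem b s hs)
  have hmul : ∀ (k : ℕ) y, φ (k * y) = k * φ y := fun k y ↦ by
    rw [← nsmul_eq_mul, map_nsmul, nsmul_eq_mul]
  have hc0 : 0 ≤ φ c := by simpa using hcS 1 hS.one_mem
  have hcn : φ c ≤ n := by
    have h := hφS _ hn
    rw [map_sub, ← mul_one (n : A), hmul, hφ1] at h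
    linarith
  rcases hc0.eq_or_lt with h0 | hpos
  · obtain ⟨m, hm, hm'⟩ := hS.exists_natCast_add_sub_mem hd x
    have h1 := hcS _ hm
    have h2 := hcS _ hm'
    rw [mul_add, map_add, mul_comm c, hmul] at h1
    rw [mul_sub, map_sub, mul_comm c, hmul] at h2
    rw [← h0] at h1 h2 ⊢
    linarith
  · have normalized : ∀ e : A, 0 < φ e → (∀ s ∈ S, 0 ≤ φ (e * s)) →
        (fun y ↦ (φ e)⁻¹ * φ (e * y)) ∈ stateSet S := by
      intro e he heS
      refine ⟨((φ e)⁻¹ • φ ∘ₗ LinearMap.mulLeft ℝ e).isLinear,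
        fun s hs ↦ mul_nonneg (inv_nonneg.2 he.le) (heS s hs), ?_⟩
      simp [he.ne']
    have hval : φ ((n + 1 : ℕ) - c) = n + 1 - φ c := by
      rw [map_sub, ← mul_one ((n + 1 : ℕ) : A), hmul, hφ1]; push_cast; ring
    have hpos' : 0 < φ ((n + 1 : ℕ) - c) := by rw [hval]; linarith
    have hn0 : (0 : ℝ) < n + 1 := by positivity
    have heq := hext (normalized c hpos hcS) (normalized _ hpos' hnonneg)
      ⟨φ c / (n + 1), φ ((n + 1 : ℕ) - c) / (n + 1), by positivity, by positivity,
        by rw [hval]; field_simp; ring, by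
          ext y
          simp only [Pi.add_apply, Pi.smul_apply, smul_eq_mul]
          rw [div_mul_eq_mul_div, div_mul_eq_mul_div, mul_inv_cancel_left₀ hpos.ne',
            mul_inv_cancel_left₀ hpos'.ne', sub_mul, map_sub, hmul, ← add_div, add_sub_cancel,
            Nat.cast_succ, mul_div_cancel_left₀ _ hn0.ne']⟩
    rw [← congrFun heq x, mul_inv_cancel_left₀ hpos.ne']

end IsArchimedeanPowerModule

/-- A linear functional on an `ℝ`-algebra that vanishes on all `m`-th powers is zero. -/
theorem LinearMap.eq_zero_of_forall_pow {A : Type*} [CommRing A] [Algebra ℝ A] {m : ℕ}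
    (hm : m ≠ 0) (g : A →ₗ[ℝ] ℝ) (hg : ∀ y, g (y ^ m) = 0) : g = 0 := by
  ext y
  let p : Polynomial ℝ :=
    ∑ k ∈ Finset.range (m + 1), Polynomial.monomial k (g (y ^ (m - k)) * m.choose k)
  have hp : p = 0 := by
    refine Polynomial.funext fun t ↦ ?_
    have h := hg (algebraMap ℝ A t + y)
    rw [add_pow, map_sum] at h
    rw [Polynomial.eval_zero, ← h, Polynomial.eval_finsetSum]
    refine Finset.sum_congr rfl fun k _ ↦ ?_
    rw [Polynomial.eval_monomial, ← map_pow, ← Algebra.smul_def, mul_comm _ (m.choose k : A),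
      ← nsmul_eq_mul, map_nsmul, nsmul_eq_mul, map_smul, smul_eq_mul]
    ring
  have h := congrArg (fun p ↦ Polynomial.coeff p (m - 1)) hp
  simp only [p, Polynomial.finsetSum_coeff, Polynomial.coeff_monomial, Polynomial.coeff_zero,
    Finset.sum_ite_eq', Finset.mem_range] at h
  rw [if_pos (by omega), Nat.sub_sub_self (by omega), pow_one] at h
  have hch : (m.choose (m - 1) : ℝ) ≠ 0 := by
    exact_mod_cast (Nat.choose_pos (by omega)).ne'
  exact (mul_eq_zero.1 h).resolve_right hch

/-- Jacobi's representation theorem: if `S` is an archimedean `Σ A^{2d}`-module of a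
commutative unital ℝ-algebra `A` and `α a > 0` for every unital ℝ-algebra homomorphism
`α : A → ℝ` nonnegative on `S`, then `a ∈ S`. -/
theorem stmt6 {A : Type*} [CommRing A] [Algebra ℝ A] (d : ℕ) (hd : 1 ≤ d)
    (S : Set A) (h1 : (1 : A) ∈ S) (hadd : ∀ s ∈ S, ∀ t ∈ S, s + t ∈ S)
    (hmul : ∀ a : A, ∀ s ∈ S, a ^ (2 * d) * s ∈ S)
    (harch : ∀ a : A, ∃ n : ℕ, (n : A) + a ∈ S)
    (a : A) (ha : ∀ α : A →ₐ[ℝ] ℝ, (∀ s ∈ S, 0 ≤ α s) → 0 < α a) :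
    a ∈ S := by
  by_contra haS
  have hS : IsArchimedeanPowerModule d S := ⟨h1, hadd, hmul, harch⟩
  obtain ⟨f₀, hf₀, hf₀a⟩ := hS.exists_mem_stateSet_nonpos hd haS
  have hK := hS.isCompact_stateSet hd
  let l : (A → ℝ) →L[ℝ] ℝ := -ContinuousLinearMap.proj a
  have hexp : IsExposed ℝ (stateSet S) {f ∈ stateSet S | ∀ g ∈ stateSet S, l g ≤ l f} :=
    fun _ ↦ ⟨l, rfl⟩
  obtain ⟨f₁, hf₁, hmax⟩ := hK.exists_isMaxOn ⟨f₀, hf₀⟩ l.continuous.continuousOn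
  obtain ⟨f, hf⟩ := (hexp.isCompact hK).extremePoints_nonempty ⟨f₁, hf₁, fun g hg ↦ hmax hg⟩
  have hfa : f a ≤ 0 := by
    have h : -f₀ a ≤ -f a := hf.1.2 f₀ hf₀
    linarith
  have hext := hexp.isExtreme.extremePoints_subset_extremePoints hf
  obtain ⟨hlin, hpos, hone⟩ := hext.1
  have hmulf : ∀ x y, f (x * y) = f x * f y := by
    intro x y
    let φ : A →ₗ[ℝ] ℝ := hlin.mk' f
    have h := LinearMap.eq_zero_of_forall_pow (m := 2 * d) (by omega)
      (φ ∘ₗ LinearMap.mulRight ℝ y - φ y • φ) fun z ↦ by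
        have := hS.map_pow_mul_of_mem_extremePoints hd φ hext z y
        simp [this, mul_comm (φ y)]
    have hx := LinearMap.congr_fun h x
    simp only [LinearMap.sub_apply, LinearMap.comp_apply, LinearMap.mulRight_apply,
      LinearMap.smul_apply, LinearMap.zero_apply, smul_eq_mul, sub_eq_zero] at hx
    exact hx.trans (mul_comm _ _)
  exact hfa.not_gt (ha (AlgHom.ofLinearMap (hlin.mk' f) hone hmulf) hpos)
end

section
/- Let A be a commutative unital ℝ-algebra, ρ a submultiplicative seminorm on A, and d ≥ 1. Then the ρ-closure of the cone Σ A^{2d} of finite sums of 2d-th powers equals the set of all a ∈ A with α(a) ≥ 0 for every ρ-continuous unital ℝ-algebra homomorphism α : A → ℝ. -/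
/-- The topology on `A` induced by a seminorm `ρ`. -/
noncomputable def Seminorm.mtopology {A : Type*} [AddCommGroup A] [Module ℝ A]
    (ρ : Seminorm ℝ A) : TopologicalSpace A :=
  ρ.toSeminormedAddCommGroup.toUniformSpace.toTopologicalSpace

open Filter Topology

namespace Subsemiring

variable {R : Type*} [CommRing R] [Algebra ℝ R] {P : Subsemiring R}

/-- The normalized linear functionals that are nonnegative on `P`, as a subset of `R → ℝ`. -/
def states (P : Subsemiring R) : Set (R → ℝ) :=
  {f | ((∀ x y, f (x + y) = f x + f y) ∧ ∀ (r : ℝ) x, f (r • x) = r * f x) ∧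
    (∀ x ∈ P, 0 ≤ f x) ∧ f 1 = 1}

theorem states_map_sub {f : R → ℝ} (hf : f ∈ P.states) (x y : R) : f (x - y) = f x - f y := by
  have h := hf.1.1 (x - y) y
  rw [sub_add_cancel] at h
  linarith

theorem isCompact_states (harch : ∀ x : R, ∃ r : ℝ, r • 1 - x ∈ P) : IsCompact P.states := by
  choose b hb using harch
  have hbound : P.states ⊆ Set.pi Set.univ fun x => Set.Icc (-b (-x)) (b x) := by
    intro f hf x _
    have h₁ := hf.2.1 _ (hb x)
    have h₂ := hf.2.1 _ (hb (-x))
    rw [states_map_sub hf, hf.1.2, hf.2.2] at h₁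
    rw [sub_neg_eq_add, hf.1.1, hf.1.2, hf.2.2] at h₂
    exact ⟨by linarith, by linarith⟩
  refine (isCompact_univ_pi fun _ => isCompact_Icc).of_isClosed_subset ?_ hbound
  simp only [states, Set.ofPred_and, Set.ofPred_forall]
  refine ((isClosed_iInter fun x => isClosed_iInter fun y => ?_).inter
    (isClosed_iInter fun r => isClosed_iInter fun x => ?_)).inter
    ((isClosed_iInter fun x => isClosed_iInter fun _ => ?_).inter ?_)
  · exact isClosed_eq (by fun_prop) (by fun_prop)
  · exact isClosed_eq (by fun_prop) (by fun_prop)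
  · exact isClosed_le (by fun_prop) (by fun_prop)
  · exact isClosed_eq (by fun_prop) (by fun_prop)

/-- A state vanishing at `t ∈ P` vanishes on the ideal generated by `t`. -/
theorem map_mul_eq_zero_of_mem_states (harch : ∀ x : R, ∃ r : ℝ, r • 1 - x ∈ P)
    {f : R → ℝ} (hf : f ∈ P.states) {t : R} (ht : t ∈ P) (h0 : f t = 0) (x : R) :
    f (t * x) = 0 := by
  have key : ∀ y, f (t * y) ≤ 0 := fun y => by
    obtain ⟨r, hr⟩ := harch y
    have h := hf.2.1 _ (mul_mem ht hr)
    rw [mul_sub, mul_smul_comm, mul_one, states_map_sub hf, hf.1.2, h0] at h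
    linarith
  have h := key (x - 2 • x)
  have h' : t * (x - 2 • x) = 0 - t * x := by ring
  have h0' : f 0 = 0 := by simpa using hf.1.2 0 0
  rw [h', states_map_sub hf, h0'] at h
  linarith [key x]

/-- Localizing a state at an element of `P` on which it is positive gives a state. -/
theorem localize_mem_states {f : R → ℝ} (hf : f ∈ P.states) {t : R} (ht : t ∈ P)
    (h0 : 0 < f t) : (fun x => (f t)⁻¹ * f (t * x)) ∈ P.states := by
  refine ⟨⟨fun x y => ?_, fun r x => ?_⟩, fun x hx => ?_, ?_⟩
  · simp only [mul_add, hf.1.1]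
  · simp only [mul_smul_comm, hf.1.2]
    ring
  · exact mul_nonneg (inv_nonneg.2 h0.le) (hf.2.1 _ (mul_mem ht hx))
  · simp only [mul_one]
    exact inv_mul_cancel₀ h0.ne'

theorem map_mul_of_mem_extremePoints_of_mem (harch : ∀ x : R, ∃ r : ℝ, r • 1 - x ∈ P)
    {f : R → ℝ} (hf : f ∈ P.states.extremePoints ℝ) {t : R} (ht : t ∈ P) (ht' : 1 - t ∈ P)
    (x : R) : f (t * x) = f t * f x := by
  have hs := hf.1
  have hsub : f (1 - t) = 1 - f t := by rw [states_map_sub hs, hs.2.2]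
  have hsubx : f ((1 - t) * x) = f x - f (t * x) := by
    rw [sub_mul, one_mul, states_map_sub hs]
  rcases (hs.2.1 t ht).eq_or_lt with h | h
  · rw [map_mul_eq_zero_of_mem_states harch hs ht h.symm, ← h, zero_mul]
  rcases (hs.2.1 _ ht').eq_or_lt with h' | h'
  · have := map_mul_eq_zero_of_mem_states harch hs ht' h'.symm x
    have h1 : f t = 1 := by linarith
    rw [h1]
    linarith
  have hseg : f ∈ openSegment ℝ (fun x => (f t)⁻¹ * f (t * x))
      (fun x => (f (1 - t))⁻¹ * f ((1 - t) * x)) := by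
    refine ⟨f t, f (1 - t), h, h', by linarith, ?_⟩
    funext y
    simp only [Pi.add_apply, Pi.smul_apply, smul_eq_mul]
    rw [mul_inv_cancel_left₀ h.ne', mul_inv_cancel_left₀ h'.ne', ← hs.1.1]
    congr 1
    ring
  have h₂ := congrFun (hf.2 (localize_mem_states hs ht h) (localize_mem_states hs ht' h') hseg) x
  rw [← h₂, mul_inv_cancel_left₀ h.ne']

theorem map_mul_of_mem_extremePoints (hsmul : ∀ r : ℝ, 0 ≤ r → ∀ x ∈ P, r • x ∈ P)
    (harch : ∀ x : R, ∃ r : ℝ, r • 1 - x ∈ P) {f : R → ℝ}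
    (hf : f ∈ P.states.extremePoints ℝ) (y x : R) : f (y * x) = f y * f x := by
  have hs := hf.1
  have enlarge : ∀ z : R, ∃ r : ℝ, 0 < r ∧ r • 1 - z ∈ P := fun z => by
    obtain ⟨r, hr⟩ := harch z
    refine ⟨|r| + 1, by positivity, ?_⟩
    have := add_mem hr (hsmul (|r| + 1 - r) (by linarith [le_abs_self r]) 1 (one_mem P))
    rwa [sub_add_eq_add_sub, ← add_smul, add_sub_cancel] at this
  obtain ⟨r, hr0, hr⟩ := enlarge y
  obtain ⟨s, hs0, hsy⟩ := enlarge (-y)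
  rw [sub_neg_eq_add] at hsy
  have hrs : 0 < r + s := by linarith
  have hsum : (1 : R) = (r + s)⁻¹ • (s • 1 + y) + (r + s)⁻¹ • (r • 1 - y) := by
    rw [← smul_add, add_add_sub_cancel, ← add_smul, add_comm s r, inv_smul_smul₀ hrs.ne']
  have ht := hsmul _ (inv_nonneg.2 hrs.le) _ hsy
  have ht' := hsmul _ (inv_nonneg.2 hrs.le) _ hr
  have h := map_mul_of_mem_extremePoints_of_mem harch hf ht
    (by rwa [sub_eq_of_eq_add' hsum]) x
  rw [smul_mul_assoc, hs.1.2, hs.1.2, mul_assoc] at h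
  have h := mul_left_cancel₀ (inv_pos.2 hrs).ne' h
  rw [add_mul, hs.1.1, hs.1.1, smul_mul_assoc, one_mul, hs.1.2, hs.1.2, hs.2.2] at h
  linarith

/-- The values of a state are bounded below by those of characters nonnegative on `P`. -/
theorem exists_algHom_le_of_mem_states (hsmul : ∀ r : ℝ, 0 ≤ r → ∀ x ∈ P, r • x ∈ P)
    (harch : ∀ x : R, ∃ r : ℝ, r • 1 - x ∈ P) {f : R → ℝ} (hf : f ∈ P.states) (a : R) :
    ∃ α : R →ₐ[ℝ] ℝ, (∀ x ∈ P, 0 ≤ α x) ∧ α a ≤ f a := by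
  have hK := isCompact_states harch
  let l : StrongDual ℝ (R → ℝ) := -ContinuousLinearMap.proj a
  have hexp : IsExposed ℝ P.states (l.toExposed P.states) :=
    ContinuousLinearMap.toExposed.isExposed
  have hne : (l.toExposed P.states).Nonempty := by
    obtain ⟨g, hg, hmax⟩ := hK.exists_isMaxOn ⟨f, hf⟩ l.continuous.continuousOn
    exact ⟨g, hg, hmax⟩
  obtain ⟨g, hg⟩ := (hexp.isCompact hK).extremePoints_nonempty hne
  have hgK := hexp.isExtreme.extremePoints_subset_extremePoints hg
  have hs := hgK.1
  let L : R →ₗ[ℝ] ℝ := { toFun := g, map_add' := hs.1.1, map_smul' := hs.1.2 }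
  exact ⟨AlgHom.ofLinearMap L hs.2.2 (map_mul_of_mem_extremePoints hsmul harch hgK),
    hs.2.1, neg_le_neg_iff.1 (hg.1.2 f hf)⟩

end Subsemiring

theorem eventually_nhds_one_exists_pow_eq {B : Type*} [NormedCommRing B] [NormedAlgebra ℝ B]
    [CompleteSpace B] {n : ℕ} (hn : n ≠ 0) : ∀ᶠ x in 𝓝 (1 : B), ∃ y, y ^ n = x := by
  have hn' : (n : ℝ) ≠ 0 := Nat.cast_ne_zero.2 hn
  let e : B ≃L[ℝ] B := ContinuousLinearEquiv.smulLeft (Units.mk0 (n : ℝ) hn')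
  have h : HasStrictFDerivAt (fun x : B => x ^ n) (e : B →L[ℝ] B) 1 := by
    refine ((hasStrictFDerivAt_id (𝕜 := ℝ) (1 : B)).pow n).congr_fderiv ?_
    ext x
    simp [e, Nat.cast_smul_eq_nsmul, Units.smul_def]
  have hmap := h.map_nhds_eq_of_equiv
  rw [one_pow] at hmap
  rw [← hmap, eventually_map]
  exact Eventually.of_forall fun y => ⟨y, rfl⟩

theorem eventually_nhds_one_mem_closure_range_pow {R : Type*} [SeminormedCommRing R]
    [NormedAlgebra ℝ R] {n : ℕ} (hn : n ≠ 0) :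
    ∀ᶠ x in 𝓝 (1 : R), x ∈ closure (Set.range fun y : R => y ^ n) := by
  have h := (UniformSpace.Completion.continuous_coe R).tendsto 1
  rw [UniformSpace.Completion.coe_one] at h
  filter_upwards [h.eventually (eventually_nhds_one_exists_pow_eq hn)] with x ⟨y, hy⟩
  rw [UniformSpace.Completion.isUniformInducing_coe R |>.isInducing.closure_eq_preimage_closure_image,
    Set.mem_preimage, ← hy]
  refine map_mem_closure (f := fun z : UniformSpace.Completion R => z ^ n) (by fun_prop)
    (UniformSpace.Completion.denseRange_coe y) ?_
  rintro _ ⟨z, rfl⟩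
  exact ⟨z ^ n, ⟨z, rfl⟩, UniformSpace.Completion.coeRingHom.map_pow z n⟩

/-- A closed convex subsemiring of a seminormed algebra that is a neighbourhood of `1` contains
every element at which all continuous characters nonnegative on it are nonnegative. -/
theorem Subsemiring.mem_of_forall_continuous_algHom_nonneg {R : Type*} [SeminormedCommRing R]
    [NormedAlgebra ℝ R] {P : Subsemiring R} (hsmul : ∀ r : ℝ, 0 ≤ r → ∀ x ∈ P, r • x ∈ P)
    (hclosed : IsClosed (P : Set R)) (hone : (P : Set R) ∈ 𝓝 1) {a : R}
    (ha : ∀ α : R →ₐ[ℝ] ℝ, Continuous α → (∀ x ∈ P, 0 ≤ α x) → 0 ≤ α a) : a ∈ P := by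
  have harch : ∀ x : R, ∃ r : ℝ, r • 1 - x ∈ P := fun x => by
    have ht : Tendsto (fun s : ℝ => 1 - s • x) (𝓝[>] 0) (𝓝 1) := by
      refine Tendsto.mono_left ?_ nhdsWithin_le_nhds
      have : Continuous fun s : ℝ => 1 - s • x := by fun_prop
      simpa using this.tendsto 0
    obtain ⟨s, hsP, hs⟩ := ((ht.eventually hone).and self_mem_nhdsWithin).exists
    have hs : 0 < s := hs
    refine ⟨s⁻¹, ?_⟩
    have := hsmul s⁻¹ (inv_nonneg.2 hs.le) _ hsP
    rwa [smul_sub, inv_smul_smul₀ hs.ne'] at this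
  by_contra haP
  have hconv : Convex ℝ (P : Set R) := fun x hx y hy s t hs ht _ =>
    add_mem (hsmul s hs x hx) (hsmul t ht y hy)
  obtain ⟨f, u, hfa, hfP⟩ := geometric_hahn_banach_point_closed hconv hclosed haP
  have hu : u < 0 := by simpa using hfP 0 P.zero_mem
  have hpos : ∀ x ∈ P, 0 ≤ f x := fun x hx => by
    by_contra! hneg
    have h := hfP _ (hsmul (u / f x) (div_nonneg_of_nonpos hu.le hneg.le) x hx)
    rw [map_smul, smul_eq_mul, div_mul_cancel₀ _ hneg.ne] at h
    exact lt_irrefl _ h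
  have hf1 : 0 < f 1 := by
    refine (hpos 1 P.one_mem).lt_of_ne fun h0 => ?_
    obtain ⟨r, hr⟩ := harch (-a)
    have h := hpos _ hr
    rw [map_sub, map_smul, map_neg, ← h0, smul_zero] at h
    linarith
  have hstate : (fun x => (f 1)⁻¹ * f x) ∈ P.states := by
    refine ⟨⟨fun x y => ?_, fun r x => ?_⟩, fun x hx => ?_, inv_mul_cancel₀ hf1.ne'⟩
    · simp only [map_add, mul_add]
    · simp only [map_smul, smul_eq_mul, mul_left_comm]
    · exact mul_nonneg (inv_nonneg.2 hf1.le) (hpos x hx)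
  obtain ⟨α, hαP, hαa⟩ := exists_algHom_le_of_mem_states hsmul harch hstate a
  have hα : Continuous α := by
    refine continuous_of_continuousAt_zero α ?_
    rw [ContinuousAt, map_zero, Metric.tendsto_nhds]
    intro ε hε
    have hlim : ∀ c : ℝ, Tendsto (fun x : R => 1 + c • x) (𝓝 0) (𝓝 1) := fun c => by
      have : Continuous fun x : R => 1 + c • x := by fun_prop
      simpa using this.tendsto 0
    filter_upwards [(hlim (2 / ε)).eventually hone, (hlim (-(2 / ε))).eventually hone]
      with x h₁ h₂
    have h₁ := hαP _ h₁
    have h₂ := hαP _ h₂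
    rw [map_add, map_one, map_smul, smul_eq_mul] at h₁ h₂
    have hx : |2 / ε * α x| ≤ 1 := abs_le.2 ⟨by linarith, by linarith⟩
    rw [abs_mul, abs_of_pos (by positivity), div_mul_eq_mul_div, div_le_one hε] at hx
    rw [Real.dist_eq, sub_zero]
    linarith
  have h := ha α hα hαP
  have : (f 1)⁻¹ * f a < 0 := mul_neg_of_pos_of_neg (inv_pos.2 hf1) (hfa.trans hu)
  linarith

theorem closure_sums_even_powers_eq {R : Type*} [SeminormedCommRing R] [NormedAlgebra ℝ R]
    (d : ℕ) (hd : 1 ≤ d) :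
    closure (AddSubmonoid.closure {x : R | ∃ b : R, x = b ^ (2 * d)} : Set R) =
      {a : R | ∀ α : R →ₐ[ℝ] ℝ, Continuous α → 0 ≤ α a} := by
  have hn : 2 * d ≠ 0 := by omega
  have hnonneg : ∀ α : R →ₐ[ℝ] ℝ, Continuous α →
      ∀ x ∈ closure (AddSubmonoid.closure {x : R | ∃ b : R, x = b ^ (2 * d)} : Set R),
        0 ≤ α x := fun α hα => by
    refine closure_minimal (t := {x | 0 ≤ α x}) (fun x hx => ?_) (isClosed_le continuous_const hα)
    change 0 ≤ α x
    induction hx using AddSubmonoid.closure_induction with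
    | mem x hx =>
      obtain ⟨b, rfl⟩ := hx
      rw [map_pow]
      exact (even_two_mul d).pow_nonneg _
    | zero => simp
    | add x y _ _ hx hy =>
      rw [map_add]
      exact add_nonneg hx hy
  refine Set.Subset.antisymm (fun x hx α hα => hnonneg α hα x hx) fun a ha => ?_
  let M : Submonoid R := MonoidHom.mrange (powMonoidHom (2 * d))
  have hM : (M : Set R) = {x : R | ∃ b : R, x = b ^ (2 * d)} := by
    ext x
    exact ⟨fun ⟨b, hb⟩ => ⟨b, hb.symm⟩, fun ⟨b, hb⟩ => ⟨b, hb.symm⟩⟩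
  let P : Subsemiring R := M.subsemiringClosure.topologicalClosure
  have hP : (P : Set R) =
      closure (AddSubmonoid.closure {x : R | ∃ b : R, x = b ^ (2 * d)} : Set R) := by
    rw [Subsemiring.topologicalClosure_coe, Submonoid.subsemiringClosure_coe, hM]
  rw [← hP]
  refine Subsemiring.mem_of_forall_continuous_algHom_nonneg (fun r hr x hx => ?_)
    (Subsemiring.isClosed_topologicalClosure _) ?_ fun α hα _ => ha α hα
  · rw [← SetLike.mem_coe, hP] at hx ⊢
    refine map_mem_closure (continuous_const_smul r) hx fun y hy => ?_
    induction hy using AddSubmonoid.closure_induction with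
    | mem y hy =>
      obtain ⟨b, rfl⟩ := hy
      refine AddSubmonoid.subset_closure ⟨(r ^ ((2 * d : ℕ) : ℝ)⁻¹) • b, ?_⟩
      rw [smul_pow, Real.rpow_inv_natCast_pow hr hn]
    | zero => simp
    | add x y _ _ hx hy =>
      rw [smul_add]
      exact add_mem hx hy
  · rw [hP]
    filter_upwards [eventually_nhds_one_mem_closure_range_pow hn] with x hx
    refine closure_mono ?_ hx
    rintro _ ⟨b, rfl⟩
    exact AddSubmonoid.subset_closure ⟨b, rfl⟩

/-- The `ρ`-closure of the cone of sums of `2d`-th powers of `A` equals the set of elements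
nonnegative under every `ρ`-continuous unital ℝ-algebra homomorphism `A → ℝ`. -/
theorem stmt9 {A : Type*} [CommRing A] [Algebra ℝ A] (ρ : Seminorm ℝ A)
    (hsub : ∀ x y : A, ρ (x * y) ≤ ρ x * ρ y) (d : ℕ) (hd : 1 ≤ d) :
    @closure A ρ.mtopology
        (AddSubmonoid.closure {x : A | ∃ b : A, x = b ^ (2 * d)} : Set A) =
      {a : A | ∀ α : A →ₐ[ℝ] ℝ, @Continuous A ℝ ρ.mtopology inferInstance ⇑α → 0 ≤ α a} := by
  let i : SeminormedCommRing A :=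
    { ‹CommRing A›, ρ.toSeminormedAddCommGroup with norm_mul_le := hsub }
  let j : NormedAlgebra ℝ A :=
    { ‹Algebra ℝ A› with norm_smul_le := fun r x => (map_smul_eq_mul ρ r x).le }
  exact @closure_sums_even_powers_eq A i j d hd
end

section
/- Let A be a commutative unital ℝ-algebra equipped with its finest lmc topology η (generated by all submultiplicative seminorms on A), and let d ≥ 1. For any Σ A^{2d}-module S of A, the η-closure of S equals {a ∈ A : α(a) ≥ 0 for every unital ℝ-algebra homomorphism α : A → ℝ nonnegative on S}. In particular, cl_η(Σ A^{2d}) = {a ∈ A : α(a) ≥ 0 for all α ∈ V(A)}. -/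
/-- The finest lmc topology on `A`: the topology generated by all submultiplicative
seminorms on `A`, i.e. the infimum of the topologies they individually induce. -/
noncomputable def finestLmc (A : Type*) [CommRing A] [Algebra ℝ A] : TopologicalSpace A :=
  ⨅ ρ : {ρ : Seminorm ℝ A // ∀ x y : A, ρ (x * y) ≤ ρ x * ρ y},
    (ρ : Seminorm ℝ A).mtopology

open Topology

theorem exists_pos_norm_smul_lt {E : Type*} [SeminormedAddCommGroup E] [NormedSpace ℝ E] (x : E)
    {δ : ℝ} (hδ : 0 < δ) : ∃ r : ℝ, 0 < r ∧ ‖r • x‖ < δ := by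
  refine ⟨δ / (‖x‖ + 1), by positivity, ?_⟩
  rw [norm_smul, Real.norm_of_nonneg (by positivity), div_mul_eq_mul_div,
    div_lt_iff₀ (by positivity)]
  exact mul_lt_mul_of_pos_left (by linarith) hδ

/-- In a commutative Banach algebra, every element close to `1` is an `n`-th power. -/
theorem exists_pow_eq_one_add_of_norm_lt {B : Type*} [NormedCommRing B] [NormedAlgebra ℝ B]
    [CompleteSpace B] {n : ℕ} (hn : n ≠ 0) :
    ∃ δ > 0, ∀ y : B, ‖y‖ < δ → ∃ x : B, x ^ n = 1 + y := by
  have hn' : (n : ℝ) ≠ 0 := Nat.cast_ne_zero.mpr hn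
  have hderiv : HasStrictFDerivAt (fun x : B ↦ x ^ n)
      ((ContinuousLinearEquiv.smulLeft (Units.mk0 (n : ℝ) hn') : B ≃L[ℝ] B) : B →L[ℝ] B) 1 := by
    refine ((hasStrictFDerivAt_id (𝕜 := ℝ) (1 : B)).pow n).congr_fderiv ?_
    ext y
    simp [Units.smul_def, Nat.cast_smul_eq_nsmul]
  have hmap := hderiv.map_nhds_eq_of_equiv
  rw [one_pow] at hmap
  have hrange : Set.range (fun x : B ↦ x ^ n) ∈ 𝓝 (1 : B) := by
    rw [← hmap]
    exact Filter.range_mem_map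
  obtain ⟨δ, hδ, h⟩ := Metric.mem_nhds_iff.mp hrange
  exact ⟨δ, hδ, fun y hy ↦ h (by simpa using hy)⟩

/-- The normalized continuous linear functionals that are nonnegative on `T`. -/
def statesOn {B : Type*} [NormedCommRing B] [NormedAlgebra ℝ B] (T : Set B) :
    Set (WeakDual ℝ B) :=
  {L | L 1 = 1 ∧ ∀ t ∈ T, 0 ≤ L t}

section States

variable {B : Type*} [NormedCommRing B] [NormedAlgebra ℝ B] {T : Set B} {δ : ℝ}

theorem abs_apply_le_apply_one {L : WeakDual ℝ B} (h1 : (1 : B) ∈ T)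
    (hT : ∀ y : B, ‖y‖ < δ → ∀ t ∈ T, (1 + y) * t ∈ T) (hL : ∀ t ∈ T, 0 ≤ L t)
    {y : B} (hy : ‖y‖ < δ) : |L y| ≤ L 1 := by
  have hpos := hL _ (hT y hy 1 h1)
  have hneg := hL _ (hT (-y) (by rwa [norm_neg]) 1 h1)
  rw [mul_one, map_add] at hpos hneg
  rw [map_neg] at hneg
  exact abs_le.mpr ⟨by linarith, by linarith⟩

theorem isCompact_statesOn (hδ : 0 < δ) (h1 : (1 : B) ∈ T)
    (hT : ∀ y : B, ‖y‖ < δ → ∀ t ∈ T, (1 + y) * t ∈ T) : IsCompact (statesOn T) := by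
  refine (WeakDual.isCompact_polar ℝ (Metric.ball_mem_nhds (0 : B) hδ)).of_isClosed_subset ?_ ?_
  · have : statesOn T = {L : WeakDual ℝ B | L 1 = 1} ∩ ⋂ t ∈ T, {L : WeakDual ℝ B | 0 ≤ L t} := by
      ext L
      simp [statesOn]
    rw [this]
    exact (isClosed_eq (WeakDual.eval_continuous 1) continuous_const).inter
      (isClosed_biInter fun t _ ↦ isClosed_le continuous_const (WeakDual.eval_continuous t))
  · intro L hL y hy
    rw [← hL.1]
    exact abs_apply_le_apply_one h1 hT hL.2 (by simpa using hy)

/-- The functional `x ↦ c⁻¹ * L (u * x)`. -/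
noncomputable def WeakDual.localize (L : WeakDual ℝ B) (u : B) (c : ℝ) : WeakDual ℝ B :=
  StrongDual.toWeakDual (c⁻¹ • (WeakDual.toStrongDual L).comp (ContinuousLinearMap.mul ℝ B u))

theorem WeakDual.localize_apply (L : WeakDual ℝ B) (u : B) (c : ℝ) (x : B) :
    L.localize u c x = c⁻¹ * L (u * x) := rfl

/-- Extreme states are multiplicative. -/
theorem map_mul_of_mem_extremePoints_statesOn {L : WeakDual ℝ B} (hδ : 0 < δ) (h1 : (1 : B) ∈ T)
    (hT : ∀ y : B, ‖y‖ < δ → ∀ t ∈ T, (1 + y) * t ∈ T)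
    (hL : L ∈ (statesOn T).extremePoints ℝ) (x y : B) : L (x * y) = L x * L y := by
  have hLS : L ∈ statesOn T := hL.1
  have hsmall : ∀ z : B, ‖z‖ < δ / 2 → L (z * y) = L z * L y := by
    intro z hz
    have hz' : ‖z‖ < δ := by linarith
    have hbound : |L z| ≤ 1 / 2 := by
      have h := abs_apply_le_apply_one h1 hT hLS.2 (y := (2 : ℝ) • z)
        (by rw [norm_smul]; norm_num; linarith)
      rw [hLS.1, map_smul, smul_eq_mul, abs_mul, abs_two] at h
      linarith
    obtain ⟨hlow, hupp⟩ := abs_le.mp hbound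
    have hstate : ∀ w : B, ‖w‖ < δ → 0 < 1 + L w →
        L.localize (1 + w) (1 + L w) ∈ statesOn T := by
      intro w hw hpos
      refine ⟨?_, fun t ht ↦ ?_⟩
      · rw [WeakDual.localize_apply, mul_one, map_add, hLS.1, inv_mul_cancel₀ hpos.ne']
      · rw [WeakDual.localize_apply]
        exact mul_nonneg (inv_nonneg.mpr hpos.le) (hLS.2 _ (hT w hw t ht))
    have hpos : 0 < 1 + L z := by linarith
    have hneg : 0 < 1 + L (-z) := by rw [map_neg]; linarith
    have heq := hL.2 (hstate z hz' hpos) (hstate (-z) (by rwa [norm_neg]) hneg)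
      ⟨(1 + L z) / 2, (1 + L (-z)) / 2, by linarith, by linarith, by rw [map_neg]; ring, by
        refine DFunLike.ext _ _ fun v ↦ ?_
        change (1 + L z) / 2 * L.localize (1 + z) (1 + L z) v +
          (1 + L (-z)) / 2 * L.localize (1 + -z) (1 + L (-z)) v = L v
        rw [WeakDual.localize_apply, WeakDual.localize_apply]
        field_simp
        rw [← map_add, ← add_mul, add_add_add_comm, add_neg_cancel, add_zero, add_mul, one_mul,
          map_add]
        ring⟩
    have happ := DFunLike.congr_fun heq y
    rw [WeakDual.localize_apply, inv_mul_eq_iff_eq_mul₀ hpos.ne', add_mul, one_mul, map_add] at happ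
    linarith
  obtain ⟨r, hr, hrx⟩ : ∃ r : ℝ, 0 < r ∧ ‖r • x‖ < δ / 2 :=
    exists_pos_norm_smul_lt x (half_pos hδ)
  have h := hsmall _ hrx
  rw [smul_mul_assoc, map_smul, map_smul, smul_eq_mul, smul_eq_mul, mul_assoc] at h
  exact mul_left_cancel₀ hr.ne' h

end States

/-- A closed module over the sums of `n`-th powers in a commutative Banach algebra contains every
element at which all characters that are nonnegative on the module are nonnegative. -/
theorem mem_of_forall_algHom_nonneg {B : Type*} [NormedCommRing B] [NormedAlgebra ℝ B]
    [CompleteSpace B] {n : ℕ} (hn : n ≠ 0) {T : Set B} (hclosed : IsClosed T)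
    (h1 : (1 : B) ∈ T) (hadd : ∀ s ∈ T, ∀ t ∈ T, s + t ∈ T)
    (hmul : ∀ a : B, ∀ s ∈ T, a ^ n * s ∈ T) {b : B}
    (hb : ∀ α : B →ₐ[ℝ] ℝ, (∀ t ∈ T, 0 ≤ α t) → 0 ≤ α b) : b ∈ T := by
  by_contra hbT
  obtain ⟨δ, hδ, hroot⟩ := exists_pow_eq_one_add_of_norm_lt (B := B) hn
  have hT : ∀ y : B, ‖y‖ < δ → ∀ t ∈ T, (1 + y) * t ∈ T := by
    intro y hy t ht
    obtain ⟨x, hx⟩ := hroot y hy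
    exact hx ▸ hmul x t ht
  have hsmul : ∀ (r : ℝ), 0 ≤ r → ∀ t ∈ T, r • t ∈ T := by
    intro r hr t ht
    have h := hmul (algebraMap ℝ B (r ^ (n⁻¹ : ℝ))) t ht
    rwa [← map_pow, Real.rpow_inv_natCast_pow hr hn, ← Algebra.smul_def] at h
  let C : ProperCone ℝ B :=
    { carrier := T
      add_mem' := fun hs ht ↦ hadd _ hs _ ht
      zero_mem' := by simpa using hsmul 0 le_rfl 1 h1
      smul_mem' := fun r _ ht ↦ hsmul r r.2 _ ht
      isClosed' := hclosed }
  obtain ⟨f, hf, hfb⟩ := C.hyperplane_separation_point (x₀ := b) hbT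
  let F : WeakDual ℝ B := StrongDual.toWeakDual f
  have hF1 : 0 < F 1 := by
    obtain ⟨r, hr, hrb⟩ : ∃ r : ℝ, 0 < r ∧ ‖r • b‖ < δ :=
      exists_pos_norm_smul_lt b hδ
    refine lt_of_lt_of_le ?_ (abs_apply_le_apply_one (L := F) h1 hT hf hrb)
    rw [map_smul, smul_eq_mul]
    exact abs_pos.mpr (mul_neg_of_pos_of_neg hr hfb).ne
  have hFS : F.localize 1 (F 1) ∈ statesOn T := by
    refine ⟨?_, fun t ht ↦ ?_⟩
    · rw [WeakDual.localize_apply, one_mul, inv_mul_cancel₀ hF1.ne']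
    · rw [WeakDual.localize_apply, one_mul]
      exact mul_nonneg (inv_nonneg.mpr hF1.le) (hf t ht)
  have hcompact := isCompact_statesOn hδ h1 hT
  let ev : StrongDual ℝ (WeakDual ℝ B) :=
    { toFun := fun L ↦ -L b
      map_add' := fun L M ↦ neg_add (L b) (M b)
      map_smul' := fun r L ↦ (mul_neg r (L b)).symm
      cont := (WeakDual.eval_continuous b).neg }
  have hexposed : IsExposed ℝ (statesOn T) (ev.toExposed (statesOn T)) :=
    ContinuousLinearMap.toExposed.isExposed
  obtain ⟨M, hM, hmax⟩ := hcompact.exists_isMaxOn ⟨_, hFS⟩ ev.continuous.continuousOn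
  have : LocallyConvexSpace ℝ (WeakDual ℝ B) :=
    inferInstanceAs (LocallyConvexSpace ℝ (WeakBilin (topDualPairing ℝ B)))
  obtain ⟨L, hL⟩ := (hexposed.isCompact hcompact).extremePoints_nonempty ⟨M, hM, hmax⟩
  have hLext := hexposed.isExtreme.extremePoints_subset_extremePoints hL
  have hLb : L b < 0 := by
    have h : -F.localize 1 (F 1) b ≤ -L b := hL.1.2 _ hFS
    rw [WeakDual.localize_apply, one_mul] at h
    have := mul_neg_of_pos_of_neg (inv_pos.mpr hF1) hfb
    change (F 1)⁻¹ * F b < 0 at this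
    linarith
  let α : B →ₐ[ℝ] ℝ := AlgHom.ofLinearMap (WeakDual.toStrongDual L).toLinearMap hLext.1.1
    (map_mul_of_mem_extremePoints_statesOn hδ h1 hT hLext)
  exact hLb.not_ge (hb α hLext.1.2)

/-- The seminormed version of `mem_of_forall_algHom_nonneg`, proved by completion. -/
theorem mem_closure_of_forall_algHom_nonneg {A : Type*} [SeminormedCommRing A] [NormedAlgebra ℝ A]
    {n : ℕ} (hn : n ≠ 0) {S : Set A} (h1 : (1 : A) ∈ S) (hadd : ∀ s ∈ S, ∀ t ∈ S, s + t ∈ S)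
    (hmul : ∀ a : A, ∀ s ∈ S, a ^ n * s ∈ S) {a : A}
    (ha : ∀ α : A →ₐ[ℝ] ℝ, (∀ s ∈ S, 0 ≤ α s) → 0 ≤ α a) : a ∈ closure S := by
  let φ : A → UniformSpace.Completion A := (↑)
  have hφ : Topology.IsInducing φ := (UniformSpace.Completion.isUniformInducing_coe A).isInducing
  rw [hφ.closure_eq_preimage_closure_image]
  have hmem : ∀ s ∈ S, φ s ∈ closure (φ '' S) := fun s hs ↦ subset_closure ⟨s, hs, rfl⟩
  refine mem_of_forall_algHom_nonneg hn isClosed_closure ?_ ?_ ?_ ?_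
  · exact UniformSpace.Completion.coe_one A ▸ hmem 1 h1
  · refine fun s hs t ht ↦ map_mem_closure₂ continuous_add hs ht ?_
    rintro _ ⟨s, hs, rfl⟩ _ ⟨t, ht, rfl⟩
    exact ⟨s + t, hadd s hs t ht, UniformSpace.Completion.coe_add s t⟩
  · intro x s hs
    refine map_mem_closure₂ (f := fun x s ↦ x ^ n * s) (by fun_prop)
      (UniformSpace.Completion.denseRange_coe x) hs ?_
    rintro _ ⟨x, rfl⟩ _ ⟨s, hs, rfl⟩
    refine ⟨x ^ n * s, hmul x s hs, ?_⟩
    exact (UniformSpace.Completion.coe_mul _ _).trans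
      (congrArg (· * φ s) (map_pow UniformSpace.Completion.coeRingHom x n))
  · intro α hα
    exact ha (α.comp { UniformSpace.Completion.coeRingHom with
      commutes' := fun _ ↦ rfl }) fun s hs ↦ hα _ (hmem s hs)

theorem Seminorm.hasBasis_nhds_mtopology {A : Type*} [AddCommGroup A] [Module ℝ A]
    (ρ : Seminorm ℝ A) (a : A) :
    (@nhds A ρ.mtopology a).HasBasis (fun ε : ℝ ↦ 0 < ε) fun ε ↦ {x | ρ (x - a) < ε} := by
  let _ := ρ.toSeminormedAddCommGroup
  have hball : ∀ ε, {x | ρ (x - a) < ε} = Metric.ball a ε := fun ε ↦ by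
    ext x
    rw [mem_ball_iff_norm]
    rfl
  simp_rw [hball]
  exact Metric.nhds_basis_ball

theorem mem_nhds_finestLmc {A : Type*} [CommRing A] [Algebra ℝ A] {a : A} {U : Set A} :
    U ∈ @nhds A (finestLmc A) a ↔ ∃ ρ : Seminorm ℝ A, (∀ x y : A, ρ (x * y) ≤ ρ x * ρ y) ∧
      U ∈ @nhds A ρ.mtopology a := by
  have hanti : ∀ ρ σ : Seminorm ℝ A, ρ ≤ σ → @nhds A σ.mtopology a ≤ @nhds A ρ.mtopology a := by
    intro ρ σ h
    rw [(σ.hasBasis_nhds_mtopology a).le_basis_iff (ρ.hasBasis_nhds_mtopology a)]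
    exact fun ε hε ↦ ⟨ε, hε, fun x hx ↦ (h (x - a)).trans_lt hx⟩
  have : Nonempty {ρ : Seminorm ℝ A // ∀ x y : A, ρ (x * y) ≤ ρ x * ρ y} := ⟨⟨0, by simp⟩⟩
  rw [finestLmc, nhds_iInf, Filter.mem_iInf_of_directed]
  · exact ⟨fun ⟨⟨ρ, hρ⟩, h⟩ ↦ ⟨ρ, hρ, h⟩, fun ⟨ρ, hρ, h⟩ ↦ ⟨⟨ρ, hρ⟩, h⟩⟩
  · rintro ⟨ρ, hρ⟩ ⟨σ, hσ⟩
    refine ⟨⟨ρ ⊔ σ, fun x y ↦ ?_⟩, hanti _ _ le_sup_left, hanti _ _ le_sup_right⟩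
    simp only [Seminorm.sup_apply]
    refine sup_le ((hρ x y).trans ?_) ((hσ x y).trans ?_)
    · exact mul_le_mul le_sup_left le_sup_left (apply_nonneg _ _)
        (le_sup_of_le_left (apply_nonneg _ _))
    · exact mul_le_mul le_sup_right le_sup_right (apply_nonneg _ _)
        (le_sup_of_le_left (apply_nonneg _ _))

theorem mem_closure_finestLmc {A : Type*} [CommRing A] [Algebra ℝ A] {a : A} {S : Set A} :
    a ∈ @closure A (finestLmc A) S ↔ ∀ ρ : Seminorm ℝ A, (∀ x y : A, ρ (x * y) ≤ ρ x * ρ y) →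
      a ∈ @closure A ρ.mtopology S := by
  simp only [@mem_closure_iff_nhds A, mem_nhds_finestLmc]
  exact ⟨fun h ρ hρ U hU ↦ h U ⟨ρ, hρ, hU⟩, fun h U ⟨ρ, hρ, hU⟩ ↦ h ρ hρ U hU⟩

/-- The closure of a module over sums of `n`-th powers in the finest lmc topology. -/
theorem closure_finestLmc_eq {A : Type*} [CommRing A] [Algebra ℝ A] {n : ℕ} (hn : n ≠ 0)
    {S : Set A} (h1 : (1 : A) ∈ S) (hadd : ∀ s ∈ S, ∀ t ∈ S, s + t ∈ S)
    (hmul : ∀ a : A, ∀ s ∈ S, a ^ n * s ∈ S) :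
    @closure A (finestLmc A) S =
      {a : A | ∀ α : A →ₐ[ℝ] ℝ, (∀ s ∈ S, 0 ≤ α s) → 0 ≤ α a} := by
  ext a
  rw [mem_closure_finestLmc]
  constructor
  · intro h α hα
    let ρ : Seminorm ℝ A := (normSeminorm ℝ ℝ).comp α.toLinearMap
    have hρ : ∀ x, ρ x = |α x| := fun _ ↦ rfl
    have ha := h ρ fun x y ↦ by simp [hρ, abs_mul]
    refine le_of_forall_pos_lt_add fun ε hε ↦ ?_
    obtain ⟨s, hsa, hs⟩ := (@mem_closure_iff_nhds A ρ.mtopology _ _).mp ha _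
      ((ρ.hasBasis_nhds_mtopology a).mem_of_mem hε)
    have hsa' : |α (s - a)| < ε := hsa
    rw [map_sub] at hsa'
    linarith [(abs_lt.mp hsa').2, hα s hs]
  · intro ha ρ hρ
    let _ : SeminormedCommRing A :=
      { ‹CommRing A›, ρ.toSeminormedAddCommGroup with norm_mul_le := hρ }
    let _ : NormedAlgebra ℝ A :=
      { ‹Algebra ℝ A› with norm_smul_le := fun r x ↦ (map_smul_eq_mul ρ r x).le }
    exact mem_closure_of_forall_algHom_nonneg hn h1 hadd hmul ha

/-- For the finest lmc topology `η` on `A` and any `Σ A^{2d}`-module `S`, the `η`-closure of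
`S` is `{a | α a ≥ 0 for every ℝ-algebra homomorphism α : A → ℝ nonnegative on S}`; in
particular the `η`-closure of `Σ A^{2d}` is `{a | α a ≥ 0 for all α ∈ V(A)}`. -/
theorem stmt18 {A : Type*} [CommRing A] [Algebra ℝ A] (d : ℕ) (hd : 1 ≤ d)
    (S : Set A) (h1 : (1 : A) ∈ S) (hadd : ∀ s ∈ S, ∀ t ∈ S, s + t ∈ S)
    (hmul : ∀ a : A, ∀ s ∈ S, a ^ (2 * d) * s ∈ S) :
    @closure A (finestLmc A) S =
      {a : A | ∀ α : A →ₐ[ℝ] ℝ, (∀ s ∈ S, 0 ≤ α s) → 0 ≤ α a} ∧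
    @closure A (finestLmc A)
        (AddSubmonoid.closure {x : A | ∃ b : A, x = b ^ (2 * d)} : Set A) =
      {a : A | ∀ α : A →ₐ[ℝ] ℝ, 0 ≤ α a} := by
  have hn : 2 * d ≠ 0 := by lia
  refine ⟨closure_finestLmc_eq hn h1 hadd hmul, ?_⟩
  rw [closure_finestLmc_eq hn]
  · ext a
    refine forall_congr' fun α ↦ ⟨fun h ↦ h fun s hs ↦ ?_, fun h _ ↦ h⟩
    induction hs using AddSubmonoid.closure_induction with
    | mem x hx =>
      obtain ⟨b, rfl⟩ := hx
      rw [map_pow]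
      exact (even_two_mul d).pow_nonneg _
    | zero => rw [map_zero]
    | add x y _ _ hx hy => rw [map_add]; exact add_nonneg hx hy
  · exact AddSubmonoid.subset_closure ⟨1, (one_pow _).symm⟩
  · exact fun s hs t ht ↦ add_mem hs ht
  · intro a s hs
    induction hs using AddSubmonoid.closure_induction with
    | mem x hx =>
      obtain ⟨b, rfl⟩ := hx
      exact AddSubmonoid.subset_closure ⟨a * b, (mul_pow a b _).symm⟩
    | zero => rw [mul_zero]; exact zero_mem _
    | add x y _ _ hx hy => rw [mul_add]; exact add_mem hx hy
end
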